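/- arXiv:math/0303382 — 2 statements merged into one kernel-verified Lean document; each statement's English description precedes it below -/
import Mathlib

section
/- Let X be a projective scheme over a field k of dimension n, and let L be an ample line bundle on X. Suppose L admits linearly independent global sections α_0, …, α_n whose zero loci have no common intersection. Then the sections α_0, …, α_n induce a finite morphism X → ℙ^n_k. -/
/-!
Formalization of results from "More étale covers of affine spaces in positive
characteristic" (K. Kedlaya).

Mathlib does not yet have a theory of invertible sheaves (line bundles) on schemes, so
the notions of a line bundle, its tensor powers, global sections and their vanishing
loci, and the morphism to projective space induced by a tuple of sections without common
zeros, are recorded by the structure `LineBundle` below, which axiomatises the standard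
interface of these objects.  Projective space `ℙ^n_k` is taken to be `Proj` of the
polynomial ring in `n + 1` variables.
-/

open AlgebraicGeometry CategoryTheory

attribute [local instance] MvPolynomial.gradedAlgebra

noncomputable section

universe u

/-- Projective `n`-space over `k`, as `Proj` of the polynomial ring in `n+1` variables. -/
def ProjSpace (k : Type u) [CommRing k] (n : ℕ) : Scheme.{u} :=
  Proj (MvPolynomial.homogeneousSubmodule (Fin (n + 1)) k)

/-- The canonical map from `k` to the degree-zero part of the polynomial ring. -/
def gradeZeroInclusion (k : Type u) [CommRing k] (n : ℕ) :
    k →+* ↥(MvPolynomial.homogeneousSubmodule (Fin (n + 1)) k 0) where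
  toFun c := ⟨MvPolynomial.C c, MvPolynomial.isHomogeneous_C _ _⟩
  map_one' := by ext; simp
  map_mul' x y := by ext; simp
  map_zero' := by ext; simp
  map_add' x y := by ext; simp

/-- The structure morphism of projective `n`-space over `k`. -/
def ProjSpace.structMap (k : Type u) [Field k] (n : ℕ) :
    ProjSpace k n ⟶ Spec (CommRingCat.of k) :=
  Proj.toSpecZero _ ≫ Spec.map (CommRingCat.ofHom (gradeZeroInclusion k n))

/-- The `i`-th coordinate hyperplane in `ℙ^n_k`; for `i = 0` this is the hyperplane `H`
at infinity. -/
def ProjSpace.hyperplane (k : Type u) [Field k] (n : ℕ) (i : Fin (n + 1)) :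
    Set (ProjSpace k n) :=
  ProjectiveSpectrum.zeroLocus _ {MvPolynomial.X i}

/-- The complement of the `i`-th coordinate hyperplane in `ℙ^n_k`. -/
def ProjSpace.awayFrom (k : Type u) [Field k] (n : ℕ) (i : Fin (n + 1)) :
    (ProjSpace k n).Opens :=
  Proj.basicOpen _ (MvPolynomial.X i)

variable {k : Type u} [Field k] {X : Scheme.{u}}

/-- The smooth locus of a `k`-scheme: the set of points admitting an open neighbourhood on
which the structure morphism is smooth. -/
def smoothLocus (fX : X ⟶ Spec (CommRingCat.of k)) : Set X :=
  {x | ∃ U : X.Opens, x ∈ U ∧ IsSmooth (U.ι ≫ fX)}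

/-- A `k`-scheme is geometrically reduced if its base change to an algebraic closure of `k`
is reduced. -/
def GeometricallyReduced (fX : X ⟶ Spec (CommRingCat.of k)) : Prop :=
  IsReduced (Limits.pullback fX
    (Spec.map (CommRingCat.ofHom (algebraMap k (AlgebraicClosure k)))))

/-- A scheme has pure dimension `n` if every irreducible component of it has topological
Krull dimension `n`. -/
def PureDimension (X : Scheme.{u}) (n : ℕ) : Prop :=
  ∀ Z ∈ irreducibleComponents X, topologicalKrullDim Z = (n : WithBot ℕ∞)

/-- A `k`-scheme is projective over `k` if it admits a closed immersion into some
projective space `ℙ^N_k` over `k`. -/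
def IsProjectiveOver (fX : X ⟶ Spec (CommRingCat.of k)) : Prop :=
  ∃ (N : ℕ) (g : X ⟶ ProjSpace k N), IsClosedImmersion g ∧ g ≫ ProjSpace.structMap k N = fX

/-- The data of a line bundle `L` on a `k`-scheme `X`, recorded through the modules of
global sections of its tensor powers `L^⊗l`, together with the vanishing loci of sections
and the morphisms to projective space induced by tuples of sections without common zeros.
(`sections l` plays the role of `Γ(X, L^⊗l)`, `mul` is the multiplication
`Γ(X, L^⊗a) × Γ(X, L^⊗b) → Γ(X, L^⊗(a+b))`, `one` is the canonical section `1` of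
`L^⊗0 = 𝒪_X`, and `inducedMap s h` is the morphism `x ↦ [s 0 (x) : ⋯ : s n (x)]`.) -/
structure LineBundle (fX : X ⟶ Spec (CommRingCat.of k)) : Type (u + 1) where
  sections : ℕ → Type u
  [instAddCommGroup : ∀ l, AddCommGroup (sections l)]
  [instModule : ∀ l, Module Γ(X, ⊤) (sections l)]
  one : sections 0
  mul : ∀ {a b : ℕ}, sections a → sections b → sections (a + b)
  zeroLocus : ∀ {l : ℕ}, sections l → Set X
  zeroLocus_closed : ∀ {l : ℕ} (s : sections l), IsClosed (zeroLocus s)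
  zeroLocus_one : zeroLocus one = ∅
  zeroLocus_zero : ∀ l : ℕ, zeroLocus (0 : sections l) = Set.univ
  zeroLocus_mul : ∀ {a b : ℕ} (s : sections a) (t : sections b),
    zeroLocus (mul s t) = zeroLocus s ∪ zeroLocus t
  inducedMap : ∀ {l n : ℕ} (s : Fin (n + 1) → sections l),
    (⋂ i, zeroLocus (s i)) = ∅ → (X ⟶ ProjSpace k n)
  inducedMap_over : ∀ {l n : ℕ} (s : Fin (n + 1) → sections l)
    (h : (⋂ i, zeroLocus (s i)) = ∅),
    inducedMap s h ≫ ProjSpace.structMap k n = fX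
  inducedMap_preimage : ∀ {l n : ℕ} (s : Fin (n + 1) → sections l)
    (h : (⋂ i, zeroLocus (s i)) = ∅) (i : Fin (n + 1)),
    (inducedMap s h).base ⁻¹' (ProjSpace.hyperplane k n i) = zeroLocus (s i)

attribute [instance] LineBundle.instAddCommGroup LineBundle.instModule

/-- A line bundle is ample if the nonvanishing loci of global sections of its positive
tensor powers include an affine open cover of `X`. -/
def LineBundle.IsAmple {fX : X ⟶ Spec (CommRingCat.of k)} (L : LineBundle fX) : Prop :=
  ∀ x : X, ∃ (l : ℕ) (s : L.sections l), 0 < l ∧ x ∉ L.zeroLocus s ∧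
    IsAffineOpen ⟨(L.zeroLocus s)ᶜ, (L.zeroLocus_closed s).isOpen_compl⟩

/-- The canonical map from `k` to the ring of global functions of a `k`-scheme. -/
def structureHom (fX : X ⟶ Spec (CommRingCat.of k)) : CommRingCat.of k ⟶ Γ(X, ⊤) :=
  (Scheme.ΓSpecIso (CommRingCat.of k)).inv ≫ fX.appTop


namespace AlgebraicGeometry

/-- The scheme-theoretic image of an integral scheme is integral. -/
theorem isIntegral_image {X Y : Scheme.{u}} (f : X ⟶ Y) [QuasiCompact f] [IsIntegral X] :
    IsIntegral f.image := by
  have hred : IsReduced f.image := by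
    have hcover (U : f.ker.subschemeCover.openCover.I₀) :
        IsReduced (f.ker.subschemeCover.openCover.X U) := by
      change Y.affineOpens at U
      have : _root_.IsReduced (Γ(Y, U) ⧸ f.ker.ideal U) := by
        rw [← Ideal.isRadical_iff_quotient_reduced, f.ker_apply U]
        intro x ⟨m, hm⟩
        rw [RingHom.mem_ker, map_pow] at hm
        exact eq_zero_of_pow_eq_zero hm
      exact inferInstanceAs (IsReduced (Spec (.of (Γ(Y, U) ⧸ f.ker.ideal U))))
    exact .of_openCover _ f.ker.subschemeCover.openCover
  have : IrreducibleSpace f.image := by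
    rw [irreducibleSpace_def]
    convert ((IrreducibleSpace.isIrreducible_univ X).image _
      f.toImage.continuous.continuousOn).closure
    simpa using f.toImage.denseRange.closure_range.symm
  exact isIntegral_of_irreducibleSpace_of_isReduced _

/-- A morphism from an integral scheme, universally closed over a field, is constant as soon as
its image lies in an affine open subset. -/
theorem apply_eq_of_range_subset_affineOpen {K : Type u} [Field K] {C Y : Scheme.{u}}
    [IsIntegral C] (p : C ⟶ Spec (.of K)) [UniversallyClosed p] (g : C ⟶ Y) {U : Y.Opens}
    (hU : IsAffineOpen U) (hg : ∀ c, g c ∈ U) (a b : C) : g a = g b := by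
  have hrange : Set.range g ⊆ Set.range U.ι := by
    rintro _ ⟨c, rfl⟩
    simpa using hg c
  let g' : C ⟶ U := IsOpenImmersion.lift U.ι g hrange
  have : IsAffine U := hU
  let := (isField_of_universallyClosed K p).toField
  have hsub : Subsingleton (Spec Γ(C, ⊤)) :=
    inferInstanceAs (Subsingleton (PrimeSpectrum Γ(C, ⊤)))
  have hg' : g = C.toSpecΓ ≫ Spec.map g'.appTop ≫ U.toScheme.isoSpec.inv ≫ U.ι := by
    rw [← Scheme.toSpecΓ_naturality_assoc, ← Scheme.isoSpec_hom, Iso.hom_inv_id_assoc,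
      IsOpenImmersion.lift_fac]
  rw [hg', Scheme.Hom.comp_apply C.toSpecΓ, Scheme.Hom.comp_apply C.toSpecΓ,
    Subsingleton.elim (C.toSpecΓ a) (C.toSpecΓ b)]

/-- A quasi-sober Noetherian space all of whose points are closed is finite. -/
theorem finite_of_isClosed_singleton {T : Type*} [TopologicalSpace T] [QuasiSober T]
    [TopologicalSpace.NoetherianSpace T] (h : ∀ t : T, IsClosed {t}) : Finite T := by
  have : Finite (irreducibleComponents T) :=
    TopologicalSpace.NoetherianSpace.finite_irreducibleComponents.to_subtype
  refine Finite.of_injective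
    (fun t ↦ (⟨irreducibleComponent t, irreducibleComponent_mem_irreducibleComponents t⟩ :
      irreducibleComponents T)) ?_
  have hgen (t : T) : ∃ z : T, irreducibleComponent t = {z} := by
    obtain ⟨z, hz⟩ := QuasiSober.sober (isIrreducible_irreducibleComponent (x := t))
      isClosed_irreducibleComponent
    exact ⟨z, by rw [← hz.def, (h z).closure_eq]⟩
  intro s t hst
  obtain ⟨z, hz⟩ := hgen s
  have hs : s ∈ irreducibleComponent s := mem_irreducibleComponent
  have ht : t ∈ irreducibleComponent s := by
    rw [Subtype.mk.inj hst]
    exact mem_irreducibleComponent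
  rw [hz] at hs ht
  exact hs.trans ht.symm

/-- A proper morphism has finite fibres, hence is finite, if every integral closed subscheme of a
fibre is a single point. -/
theorem IsFinite.of_isProper_of_subsingleton {X Y : Scheme.{u}} (f : X ⟶ Y) [IsProper f]
    (H : ∀ (y : Y) (C : Scheme.{u}) (c : C ⟶ f.fiber y), IsIntegral C → IsClosedImmersion c →
      Subsingleton C) : IsFinite f := by
  have : LocallyQuasiFinite f := by
    refine LocallyQuasiFinite.of_finite_preimage_singleton f fun y ↦ ?_
    have : LocallyOfFiniteType (f.fiberToSpecResidueField y) :=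
      inferInstanceAs (LocallyOfFiniteType (Limits.pullback.snd f _))
    have : IsLocallyNoetherian (f.fiber y) :=
      LocallyOfFiniteType.isLocallyNoetherian (f.fiberToSpecResidueField y)
    have : IsNoetherian (f.fiber y) := {}
    have : Finite (f.fiber y) := by
      refine finite_of_isClosed_singleton fun x ↦ ?_
      have : TopologicalSpace.NoetherianSpace (Spec ((f.fiber y).residueField x)) :=
        inferInstance
      let j : Spec ((f.fiber y).residueField x) ⟶ f.fiber y := (f.fiber y).fromSpecResidueField x
      have : QuasiCompact j := quasiCompact_of_noetherianSpace_source j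
      have hsub : Subsingleton j.image := H y j.image j.imageι (isIntegral_image j) inferInstance
      have hx : {x} = Set.range j.imageι := by
        have hmem : x ∈ Set.range j.imageι := by
          have : x ∈ Set.range j := by simp [j]
          obtain ⟨z, hz⟩ := this
          exact ⟨j.toImage z, by rw [← Scheme.Hom.comp_apply, j.toImage_imageι, hz]⟩
        exact ((Set.subsingleton_range _).eq_singleton_of_mem hmem).symm
      rw [hx]
      exact j.imageι.isClosedEmbedding.isClosed_range
    rw [← f.range_fiberι y]
    exact Set.finite_range _
  exact .of_isProper_of_locallyQuasiFinite f

end AlgebraicGeometry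

theorem gradeZeroInclusion_bijective (k : Type u) [Field k] (n : ℕ) :
    Function.Bijective (gradeZeroInclusion k n) := by
  refine ⟨fun a b hab ↦ MvPolynomial.C_injective _ _ (congrArg Subtype.val hab),
    fun ⟨p, hp⟩ ↦ ?_⟩
  have hp' : p.totalDegree = 0 :=
    Nat.le_zero.mp (MvPolynomial.IsHomogeneous.totalDegree_le hp)
  exact ⟨p.coeff 0, Subtype.ext (MvPolynomial.totalDegree_eq_zero_iff_eq_C.mp hp').symm⟩

instance ProjSpace.isProper_structMap (k : Type u) [Field k] (n : ℕ) :
    IsProper (ProjSpace.structMap k n) := by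
  have hfin : Algebra.FiniteType (MvPolynomial.homogeneousSubmodule (Fin (n + 1)) k 0)
      (MvPolynomial (Fin (n + 1)) k) := by
    have : (algebraMap (MvPolynomial.homogeneousSubmodule (Fin (n + 1)) k 0)
        (MvPolynomial (Fin (n + 1)) k)).FiniteType := by
      refine RingHom.FiniteType.of_comp_finiteType (f := gradeZeroInclusion k n) ?_
      change (MvPolynomial.C : k →+* MvPolynomial (Fin (n + 1)) k).FiniteType
      rw [← MvPolynomial.algebraMap_eq, RingHom.finiteType_algebraMap]
      infer_instance
    exact this
  have hiso : IsIso (CommRingCat.ofHom (gradeZeroInclusion k n)) :=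
    (ConcreteCategory.isIso_iff_bijective _).mpr (gradeZeroInclusion_bijective k n)
  have : IsProper (Proj.toSpecZero (MvPolynomial.homogeneousSubmodule (Fin (n + 1)) k)) :=
    inferInstance
  have : IsIso (Spec.map (CommRingCat.ofHom (gradeZeroInclusion k n))) := inferInstance
  exact MorphismProperty.comp_mem (W := @IsProper) _ _ ‹_› inferInstance

theorem ProjSpace.isAffineOpen_awayFrom (k : Type u) [Field k] (n : ℕ) (i : Fin (n + 1)) :
    IsAffineOpen (ProjSpace.awayFrom k n i) :=
  Proj.isAffineOpen_basicOpen _ _ (MvPolynomial.isHomogeneous_X k i) one_pos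

theorem ProjSpace.mem_awayFrom_iff {n : ℕ} {i : Fin (n + 1)} {x : ProjSpace k n} :
    x ∈ ProjSpace.awayFrom k n i ↔ x ∉ ProjSpace.hyperplane k n i :=
  not_congr Set.singleton_subset_iff.symm

theorem IsProjectiveOver.isProper {fX : X ⟶ Spec (CommRingCat.of k)} (hX : IsProjectiveOver fX) :
    IsProper fX := by
  obtain ⟨N, g, hg, rfl⟩ := hX
  infer_instance

namespace LineBundle

variable {fX : X ⟶ Spec (CommRingCat.of k)} (L : LineBundle fX)

/-- The tensor powers of a section of a line bundle. -/
def pow (s : L.sections 1) : ∀ l : ℕ, L.sections l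
  | 0 => L.one
  | l + 1 => L.mul (pow s l) s

theorem zeroLocus_pow_subset (s : L.sections 1) (l : ℕ) :
    L.zeroLocus (L.pow s l) ⊆ L.zeroLocus s := by
  induction l with
  | zero => simp [pow, L.zeroLocus_one]
  | succ l ih => simpa [pow, L.zeroLocus_mul] using ih

theorem inducedMap_mem_hyperplane_iff {l n : ℕ} (s : Fin (n + 1) → L.sections l)
    (h : (⋂ i, L.zeroLocus (s i)) = ∅) (i : Fin (n + 1)) (x : X) :
    L.inducedMap s h x ∈ ProjSpace.hyperplane k n i ↔ x ∈ L.zeroLocus (s i) := by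
  rw [← L.inducedMap_preimage s h i]
  rfl

/-- Let `C` be an integral scheme, universally closed over a field, with a morphism to `X` whose
image avoids the zero locus of one of finitely many sections without common zeros. Then every
section of a tensor power vanishes either everywhere on `C` or nowhere on `C`. -/
theorem mem_zeroLocus_iff {K : Type u} [Field K] {C : Scheme.{u}} [IsIntegral C]
    (p : C ⟶ Spec (.of K)) [UniversallyClosed p] (g : C ⟶ X) {n : ℕ}
    (α : Fin (n + 1) → L.sections 1) (h : (⋂ i, L.zeroLocus (α i)) = ∅) (i : Fin (n + 1))
    (hi : ∀ c, g c ∉ L.zeroLocus (α i)) {l : ℕ} (s : L.sections l) (a b : C) :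
    g a ∈ L.zeroLocus s ↔ g b ∈ L.zeroLocus s := by
  let t : Fin (n + 1 + 1) → L.sections l := Fin.cons s fun j ↦ L.pow (α j) l
  have ht : (⋂ j, L.zeroLocus (t j)) = ∅ := by
    rw [← Set.subset_empty_iff, ← h]
    exact Set.subset_iInter fun j ↦
      (Set.iInter_subset _ j.succ).trans (L.zeroLocus_pow_subset (α j) l)
  have key : L.inducedMap t ht (g a) = L.inducedMap t ht (g b) := by
    refine apply_eq_of_range_subset_affineOpen p (g ≫ L.inducedMap t ht)
      (ProjSpace.isAffineOpen_awayFrom k (n + 1) i.succ) (fun c ↦ ?_) a b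
    rw [ProjSpace.mem_awayFrom_iff, Scheme.Hom.comp_apply, L.inducedMap_mem_hyperplane_iff]
    exact fun hc ↦ hi c (L.zeroLocus_pow_subset (α i) l hc)
  have hs : t 0 = s := rfl
  rw [← hs, ← L.inducedMap_mem_hyperplane_iff t ht, key, L.inducedMap_mem_hyperplane_iff]

end LineBundle

/-- Lemma 2.2 of the paper: if an ample line bundle `L` on a projective scheme `X` of
dimension `n` over a field `k` admits `k`-linearly independent global sections
`α 0, …, α n` whose zero loci have no common intersection, then the `α i` induce a
finite morphism `X ⟶ ℙ^n_k`. -/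
theorem isFinite_inducedMap_of_no_common_zero
    (fX : X ⟶ Spec (CommRingCat.of k)) (hX : IsProjectiveOver fX)
    (n : ℕ) (hdim : topologicalKrullDim X = (n : WithBot ℕ∞))
    (L : LineBundle fX) (hL : L.IsAmple)
    (α : Fin (n + 1) → L.sections 1)
    (hindep : ∀ c : Fin (n + 1) → k,
      ∑ i, structureHom fX (c i) • α i = 0 → ∀ i, c i = 0)
    (h : (⋂ i, L.zeroLocus (α i)) = ∅) :
    IsFinite (L.inducedMap α h) := by
  have := hX.isProper
  have : IsProper (L.inducedMap α h ≫ ProjSpace.structMap k n) := by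
    rwa [L.inducedMap_over α h]
  have : IsProper (L.inducedMap α h) := .of_comp _ (ProjSpace.structMap k n)
  refine IsFinite.of_isProper_of_subsingleton _ fun y C c _ _ ↦ ⟨fun a b ↦ ?_⟩
  let f := L.inducedMap α h
  let g : C ⟶ X := c ≫ f.fiberι y
  have hgy (z : C) : f (g z) = y := by
    have : g z ∈ Set.range (f.fiberι y) := ⟨c z, rfl⟩
    rwa [f.range_fiberι y] at this
  have : UniversallyClosed (f.fiberToSpecResidueField y) :=
    inferInstanceAs (UniversallyClosed (Limits.pullback.snd f _))
  let p : C ⟶ Spec (.of ((ProjSpace k n).residueField y)) := c ≫ f.fiberToSpecResidueField y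
  have : UniversallyClosed p := inferInstanceAs (UniversallyClosed (c ≫ _))
  obtain ⟨i, hi⟩ : ∃ i, g a ∉ L.zeroLocus (α i) := by
    simpa using (h ▸ Set.notMem_empty (g a) : g a ∉ ⋂ i, L.zeroLocus (α i))
  have hi' (z : C) : g z ∉ L.zeroLocus (α i) := by
    rw [← L.inducedMap_mem_hyperplane_iff α h] at hi ⊢
    change f (g z) ∉ _
    rwa [hgy z, ← hgy a]
  obtain ⟨l, s, -, hs, haff⟩ := hL (g a)
  have hgab : g a = g b := apply_eq_of_range_subset_affineOpen p g haff
    (fun z ↦ (L.mem_zeroLocus_iff p g α h i hi' s z a).not.mpr hs) a b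
  exact c.isClosedEmbedding.injective ((f.fiberι y).isEmbedding.injective hgab)
end
end

section
/- Let f : X → Y be a morphism of schemes that are proper over a field k. If f is quasi-finite, then f is finite. -/
open AlgebraicGeometry CategoryTheory

universe u

/-- A quasi-finite (i.e. finite type with finite fibers) morphism between schemes proper
over a field `k` is finite. -/
theorem isFinite_of_quasiFinite_of_proper {k : Type u} [Field k] {X Y : Scheme.{u}}
    (fX : X ⟶ Spec (CommRingCat.of k)) (fY : Y ⟶ Spec (CommRingCat.of k))
    (hX : IsProper fX) (hY : IsProper fY)
    (f : X ⟶ Y) (hf : f ≫ fY = fX)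
    (hlft : LocallyOfFiniteType f) (hqc : QuasiCompact f)
    (hfib : ∀ y : Y, Set.Finite (f.base ⁻¹' {y})) :
    IsFinite f := by
  subst hf
  have : IsProper f := .of_comp f fY
  have : LocallyQuasiFinite f :=
    locallyQuasiFinite_iff_finite_preimage_singleton.mpr hfib
  exact .of_isProper_of_locallyQuasiFinite f
end
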